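/- arXiv:2110.12688 — 3 statements merged into one kernel-verified Lean document; each statement's English description precedes it below -/
import Mathlib

section
/- For every n ≥ 1 and every point f of the ordered configuration space Conf(S¹,n), the path component of f in Conf(S¹,n), regarded as a subspace, is homotopy equivalent to the circle S¹. -/
/-- The ordered configuration space of `n` points in `X`:
the subspace `{f : Fin n → X | f injective}` of the product `X ^ (Fin n)`. -/
abbrev Conf (X : Type*) [TopologicalSpace X] (n : ℕ) : Type _ :=
  {f : Fin n → X // Function.Injective f}

/-- The symmetric group `Σ_n = Equiv.Perm (Fin n)` acts on `Conf X n` by `σ • f = f ∘ σ⁻¹`. -/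
instance confMulAction (X : Type*) [TopologicalSpace X] (n : ℕ) :
    MulAction (Equiv.Perm (Fin n)) (Conf X n) where
  smul σ f := ⟨f.1 ∘ ⇑σ⁻¹, f.2.comp (Equiv.injective _)⟩
  one_smul _ := Subtype.ext rfl
  mul_smul _ _ _ := Subtype.ext rfl

/-- The unordered configuration space `UConf X n = Conf(X,n)/Σ_n`, with the quotient topology. -/
abbrev UConf (X : Type*) [TopologicalSpace X] (n : ℕ) : Type _ :=
  Quotient (MulAction.orbitRel (Equiv.Perm (Fin n)) (Conf X n))

namespace Circle

/-- The argument of a point of the circle, normalised to lie in `(0, 2π]`. -/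
noncomputable def posArg (z : Circle) : ℝ :=
  Complex.arg (z * Circle.exp (-Real.pi) : Circle) + Real.pi

theorem posArg_mem_Ioc (z : Circle) : posArg z ∈ Set.Ioc 0 (2 * Real.pi) := by
  have h := Complex.arg_mem_Ioc (z * Circle.exp (-Real.pi) : Circle)
  rw [Set.mem_Ioc] at h ⊢
  unfold posArg
  constructor <;> linarith [h.1, h.2]

theorem exp_posArg (z : Circle) : Circle.exp (posArg z) = z := by
  rw [posArg, Circle.exp_add, Circle.exp_arg, mul_assoc, ← Circle.exp_add]
  simp

theorem posArg_exp {x : ℝ} (hx : x ∈ Set.Ioc 0 (2 * Real.pi)) :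
    posArg (Circle.exp x) = x := by
  rw [posArg, ← Circle.exp_add, Circle.arg_exp] <;> linarith [hx.1, hx.2]

theorem posArg_injective : Function.Injective posArg :=
  Function.LeftInverse.injective exp_posArg

theorem continuousAt_posArg {z : Circle} (hz : z ≠ 1) : ContinuousAt posArg z := by
  have h : ((z * Circle.exp (-Real.pi) : Circle) : ℂ) ∈ Complex.slitPlane := by
    rw [Complex.mem_slitPlane_iff_arg]
    refine ⟨fun h => hz ?_, Circle.coe_ne_zero _⟩
    rw [← exp_posArg z, posArg, h, ← two_mul, Circle.exp_two_pi]
  have hc : Continuous fun z : Circle => ((z * Circle.exp (-Real.pi) : Circle) : ℂ) := by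
    fun_prop
  exact (ContinuousAt.comp (f := fun z : Circle => ((z * Circle.exp (-Real.pi) : Circle) : ℂ))
    (Complex.continuousAt_arg h) hc.continuousAt).add continuousAt_const

end Circle

namespace Conf

open Circle unitInterval

variable {n : ℕ}

/-- The angle in `(0, 2π]` of the `i`-th point of a configuration on the circle, measured from
its `k`-th point. -/
noncomputable def angle (k i : Fin n) (g : Conf Circle n) : ℝ :=
  posArg (g.1 i / g.1 k)

theorem angle_mem_Ioc (k i : Fin n) (g : Conf Circle n) :
    angle k i g ∈ Set.Ioc 0 (2 * Real.pi) :=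
  posArg_mem_Ioc _

theorem angle_self (k : Fin n) (g : Conf Circle n) : angle k k g = 2 * Real.pi := by
  rw [angle, div_self', ← Circle.exp_two_pi]
  exact posArg_exp ⟨Real.two_pi_pos, le_rfl⟩

theorem exp_angle (k i : Fin n) (g : Conf Circle n) :
    Circle.exp (angle k i g) = g.1 i / g.1 k :=
  exp_posArg _

theorem angle_injective (k : Fin n) (g : Conf Circle n) :
    Function.Injective fun i => angle k i g := fun _ _ h =>
  g.2 (div_left_injective (posArg_injective h))

theorem continuous_point (i : Fin n) : Continuous fun g : Conf Circle n => g.1 i :=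
  (continuous_apply i).comp continuous_subtype_val

theorem continuous_angle (k i : Fin n) : Continuous (angle k i : Conf Circle n → ℝ) := by
  rcases eq_or_ne i k with rfl | hik
  · exact continuous_const.congr fun g => (angle_self i g).symm
  · refine continuous_iff_continuousAt.2 fun g => ?_
    have hc : Continuous fun g : Conf Circle n => g.1 i / g.1 k :=
      (continuous_point i).div' (continuous_point k)
    exact ContinuousAt.comp (f := fun g : Conf Circle n => g.1 i / g.1 k)
      (continuousAt_posArg fun h => hik (g.2 (div_eq_one.1 h))) hc.continuousAt

/-- The cyclic order of a configuration on the circle is constant on path components. -/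
theorem angle_lt_angle_of_joined {f g : Conf Circle n} (h : Joined f g) {k i j : Fin n}
    (hf : angle k i f < angle k j f) : angle k i g < angle k j g := by
  by_contra! hg
  obtain ⟨γ⟩ := h
  obtain ⟨t, ht⟩ := intermediate_value_univ₂ (a := (0 : I)) (b := 1)
    ((continuous_angle k i).comp γ.continuous) ((continuous_angle k j).comp γ.continuous)
    (by simpa using hf.le) (by simpa using hg)
  exact hf.ne (by rw [angle_injective k _ ht])

/-- Linear interpolation of the angles of `g` towards those of `f`, keeping the `k`-th point
of `g` fixed. -/
noncomputable def interpolate (k : Fin n) (f g : Conf Circle n) (t : I) (i : Fin n) : Circle :=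
  g.1 k * Circle.exp ((1 - t) * angle k i g + t * angle k i f)

theorem interpolate_injective (k : Fin n) {f g : Conf Circle n} (h : Joined f g) (t : I) :
    Function.Injective (interpolate k f g t) := by
  have hlt {i j : Fin n} (hij : angle k i f < angle k j f) :
      (1 - t : ℝ) * angle k i g + t * angle k i f < (1 - t) * angle k j g + t * angle k j f := by
    have hg := angle_lt_angle_of_joined h hij
    rcases t.2.1.eq_or_lt with h0 | h0
    · simpa [← h0] using hg
    · exact add_lt_add_of_le_of_lt
        (mul_le_mul_of_nonneg_left hg.le (sub_nonneg.2 t.2.2)) (mul_lt_mul_of_pos_left hij h0)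
  have hmem (i : Fin n) : (1 - t : ℝ) * angle k i g + t * angle k i f ∈
      Set.Ioc 0 (2 * Real.pi) :=
    convex_Ioc _ _ (angle_mem_Ioc k i g) (angle_mem_Ioc k i f) (sub_nonneg.2 t.2.2) t.2.1
      (sub_add_cancel _ _)
  intro i j hij
  have heq := exp_injOn_Ioc (by simp) (hmem i) (hmem j) (mul_left_cancel hij)
  by_contra hne
  rcases lt_or_gt_of_ne ((angle_injective k f).ne hne) with hlt' | hlt'
  · exact (hlt hlt').ne heq
  · exact (hlt hlt').ne' heq

theorem interpolate_zero (k : Fin n) (f g : Conf Circle n) : interpolate k f g 0 = g.1 := by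
  ext1 i
  simp [interpolate, exp_angle]

theorem interpolate_one (k : Fin n) (f g : Conf Circle n) :
    interpolate k f g 1 = fun i => g.1 k / f.1 k * f.1 i := by
  ext1 i
  simp only [interpolate, Set.Icc.coe_one, sub_self, zero_mul, zero_add, one_mul, exp_angle]
  rw [mul_div_assoc', div_mul_eq_mul_div]

theorem continuous_interpolate (k : Fin n) (f : Conf Circle n) :
    Continuous fun p : I × Conf Circle n => interpolate k f p.2 p.1 := by
  have hangle (i : Fin n) : Continuous fun p : I × Conf Circle n => angle k i p.2 :=
    (continuous_angle k i).comp continuous_snd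
  refine continuous_pi fun i => ((continuous_point k).comp continuous_snd).mul
    (Circle.exp.continuous.comp ?_)
  fun_prop

/-- The rotation of a configuration on the circle. -/
noncomputable def rotate (f : Conf Circle n) (z : Circle) : Conf Circle n :=
  ⟨fun i => z * f.1 i, (mul_right_injective z).comp f.2⟩

theorem continuous_rotate (f : Conf Circle n) : Continuous (rotate f) := by
  unfold rotate
  fun_prop

theorem rotate_mem_pathComponent (f : Conf Circle n) (z : Circle) :
    rotate f z ∈ pathComponent f := by
  have h := (PathConnectedSpace.joined (1 : Circle) z).map (continuous_rotate f)
  have h1 : rotate f 1 = f := Subtype.ext (funext fun i => one_mul (f.1 i))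
  rwa [h1] at h

/-- The deformation of the path component of `f` onto the rotations of `f`. -/
noncomputable def deform (k : Fin n) (f : Conf Circle n) (p : I × pathComponent f) :
    Conf Circle n :=
  ⟨interpolate k f p.2 p.1, interpolate_injective k p.2.2 p.1⟩

theorem continuous_deform (k : Fin n) (f : Conf Circle n) : Continuous (deform k f) :=
  ((continuous_interpolate k f).comp (by fun_prop :
    Continuous fun p : I × pathComponent f => (p.1, (p.2 : Conf Circle n)))).subtype_mk _

theorem deform_mem_pathComponent (k : Fin n) (f : Conf Circle n) (p : I × pathComponent f) :
    deform k f p ∈ pathComponent f := by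
  have : PathConnectedSpace I := isPathConnected_iff_pathConnectedSpace.1
    ((convex_Icc (0 : ℝ) 1).isPathConnected ⟨0, unitInterval.zero_mem⟩)
  have h := (PathConnectedSpace.joined (0 : I) p.1).map
    ((continuous_deform k f).comp (by fun_prop : Continuous fun t : I => (t, p.2)))
  have h0 : deform k f (0, p.2) = p.2 := Subtype.ext (interpolate_zero k f p.2)
  simp only [Function.comp_apply, h0] at h
  exact p.2.2.trans h

/-- The path component of `f` is homotopy equivalent to the circle, through the position of the
`k`-th point in one direction and the rotations of `f` in the other. -/
noncomputable def pathComponentHomotopyEquiv (k : Fin n) (f : Conf Circle n) :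
    ContinuousMap.HomotopyEquiv (pathComponent f) Circle where
  toFun := ⟨fun g => g.1.1 k / f.1 k,
    ((continuous_point k).comp continuous_subtype_val).div' continuous_const⟩
  invFun := ⟨fun z => ⟨rotate f z, rotate_mem_pathComponent f z⟩,
    (continuous_rotate f).subtype_mk _⟩
  left_inv := by
    refine ContinuousMap.Homotopic.symm ⟨⟨⟨fun p => ⟨deform k f p, deform_mem_pathComponent k f p⟩,
      (continuous_deform k f).subtype_mk _⟩, fun g => ?_, fun g => ?_⟩⟩
    · exact Subtype.ext (Subtype.ext (interpolate_zero k f g))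
    · exact Subtype.ext (Subtype.ext (interpolate_one k f g))
  right_inv := by
    convert ContinuousMap.Homotopic.refl _ using 1
    ext1 z
    exact (mul_div_cancel_right z (f.1 k)).symm

end Conf

/-- Every path component of the ordered configuration space of the circle is homotopy
equivalent to the circle. -/
theorem stmt6 (n : ℕ) (hn : 1 ≤ n) (f : Conf Circle n) :
    Nonempty (ContinuousMap.HomotopyEquiv (pathComponent f) Circle) := by
  exact ⟨Conf.pathComponentHomotopyEquiv ⟨0, hn⟩ f⟩
end

section
/- The unordered configuration space UConf(K,2) = Conf(K,2)/Σ₂ of two points on the Y-graph K is homotopy equivalent to the circle S¹. -/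
/-- The Y-graph: the union in `ℂ` of the three segments from the origin to the
third roots of unity. -/
def Ygraph : Set ℂ :=
  ⋃ k : Fin 3, {z : ℂ | ∃ t : ℝ, t ∈ Set.Icc (0 : ℝ) 1 ∧
    z = (t : ℂ) * Complex.exp (2 * Real.pi * Complex.I * ((k : ℕ) : ℂ) / 3)}

open Set

/-- A homeomorphism induces an injection-preserving map of ordered configuration spaces. -/
def Conf.map {X Y : Type*} [TopologicalSpace X] [TopologicalSpace Y] (h : X ≃ₜ Y) (n : ℕ)
    (f : Conf X n) : Conf Y n :=
  ⟨h ∘ f.1, h.injective.comp f.2⟩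

theorem Conf.continuous_map {X Y : Type*} [TopologicalSpace X] [TopologicalSpace Y]
    (h : X ≃ₜ Y) (n : ℕ) : Continuous (Conf.map h n) := by
  refine Continuous.subtype_mk (continuous_pi fun i => ?_) _
  exact h.continuous.comp ((continuous_apply i).comp continuous_subtype_val)

/-- The map of unordered configuration spaces induced by a homeomorphism. -/
def UConf.map {X Y : Type*} [TopologicalSpace X] [TopologicalSpace Y] (h : X ≃ₜ Y) (n : ℕ) :
    UConf X n → UConf Y n :=
  Quotient.map' (Conf.map h n) (by
    rintro _ g ⟨σ, rfl⟩
    exact ⟨σ, rfl⟩)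

theorem UConf.continuous_map {X Y : Type*} [TopologicalSpace X] [TopologicalSpace Y]
    (h : X ≃ₜ Y) (n : ℕ) : Continuous (UConf.map h n) :=
  (Conf.continuous_map h n).quotient_map' _

/-- Homeomorphic spaces have homeomorphic unordered configuration spaces. -/
def UConf.congr {X Y : Type*} [TopologicalSpace X] [TopologicalSpace Y] (h : X ≃ₜ Y) (n : ℕ) :
    UConf X n ≃ₜ UConf Y n where
  toFun := UConf.map h n
  invFun := UConf.map h.symm n
  left_inv := by
    rintro ⟨f⟩
    exact congrArg _ (Subtype.ext (funext fun i => h.symm_apply_apply (f.1 i)))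
  right_inv := by
    rintro ⟨f⟩
    exact congrArg _ (Subtype.ext (funext fun i => h.apply_symm_apply (f.1 i)))
  continuous_toFun := UConf.continuous_map h n
  continuous_invFun := UConf.continuous_map h.symm n

instance confContinuousConstSMul (X : Type*) [TopologicalSpace X] (n : ℕ) :
    ContinuousConstSMul (Equiv.Perm (Fin n)) (Conf X n) where
  continuous_const_smul σ := by
    refine Continuous.subtype_mk (continuous_pi fun i => ?_) _
    exact (continuous_apply (σ⁻¹ i)).comp continuous_subtype_val

/-- The ordered configuration of two distinct points. -/
def Conf.pair {X : Type*} [TopologicalSpace X] (a b : X) (h : a ≠ b) : Conf X 2 :=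
  ⟨![a, b], by
    intro i j hij
    fin_cases i <;> fin_cases j <;> simp_all [eq_comm]⟩

theorem Conf.continuous_pair {X Z : Type*} [TopologicalSpace X] [TopologicalSpace Z]
    {a b : Z → X} (ha : Continuous a) (hb : Continuous b) (h : ∀ z, a z ≠ b z) :
    Continuous fun z => Conf.pair (a z) (b z) (h z) := by
  refine Continuous.subtype_mk (continuous_pi fun i => ?_) _
  fin_cases i
  · exact ha
  · exact hb

/-- The class of an ordered configuration in the unordered configuration space. -/
abbrev UConf.mk {X : Type*} [TopologicalSpace X] {n : ℕ} (f : Conf X n) : UConf X n :=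
  Quotient.mk _ f

theorem UConf.mk_pair_comm {X : Type*} [TopologicalSpace X] (a b : X) (h : a ≠ b) :
    UConf.mk (Conf.pair a b h) = UConf.mk (Conf.pair b a h.symm) := by
  refine Quotient.sound ⟨Equiv.swap 0 1, Subtype.ext (funext fun i => ?_)⟩
  fin_cases i <;> rfl

theorem Conf.eq_pair {X : Type*} [TopologicalSpace X] (f : Conf X 2) :
    f = Conf.pair (f.1 0) (f.1 1) (f.2.ne (by decide)) := by
  refine Subtype.ext (funext fun i => ?_)
  fin_cases i <;> rfl

theorem UConf.isOpenQuotientMap_mk (X : Type*) [TopologicalSpace X] (n : ℕ) :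
    IsOpenQuotientMap (UConf.mk : Conf X n → UConf X n) :=
  ⟨Quotient.mk_surjective, continuous_quotient_mk', isOpenMap_quotient_mk'_mul⟩

/-- To give a map on the space of unordered pairs is to give a symmetric function. -/
def UConf.lift₂ {X Z : Type*} [TopologicalSpace X] (F : Conf X 2 → Z)
    (hF : ∀ a b h, F (Conf.pair a b h) = F (Conf.pair b a h.symm)) : UConf X 2 → Z :=
  Quotient.lift F (by
    rintro f g ⟨σ, rfl⟩
    have key : σ = 1 ∨ σ = Equiv.swap 0 1 := by
      revert σ; decide
    rcases key with rfl | rfl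
    · rw [show (fun m : Equiv.Perm (Fin 2) => m • g) 1 = g from one_smul _ g]
    · have : (fun m : Equiv.Perm (Fin 2) => m • g) (Equiv.swap 0 1) =
          Conf.pair (g.1 1) (g.1 0) (g.2.ne (by decide)) := by
        refine Subtype.ext (funext fun i => ?_)
        fin_cases i <;> rfl
      rw [this, hF, ← Conf.eq_pair])

/-- The Y-graph with its leg coordinates: points of the cube with at most one nonzero
coordinate. -/
def Tripod : Set (Fin 3 → ℝ) :=
  {x | (∀ k, 0 ≤ x k ∧ x k ≤ 1) ∧ ∀ i j, i ≠ j → x i = 0 ∨ x j = 0}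

/-- The circle as the boundary of a cone: nonnegative vectors of sup norm one with a vanishing
coordinate. -/
def HollowTriangle : Set (Fin 3 → ℝ) :=
  {x | (∀ k, 0 ≤ x k) ∧ (∃ k, x k = 0) ∧ ‖x‖ = 1}

/-- The linear combination of the cube roots of unity with given real coefficients. -/
noncomputable def rootSum (x : Fin 3 → ℝ) : ℂ :=
  ⟨x 0 - x 1 / 2 - x 2 / 2, √3 / 2 * (x 1 - x 2)⟩

/-- The coefficients of sum zero expressing a complex number in the cube roots of unity. -/
noncomputable def centeredCoord (z : ℂ) : Fin 3 → ℝ :=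
  ![2 / 3 * z.re, -z.re / 3 + z.im / √3, -z.re / 3 - z.im / √3]

/-- The nonnegative coefficients, one of which vanishes, expressing a complex number in the
cube roots of unity. -/
noncomputable def legCoord (z : ℂ) (k : Fin 3) : ℝ :=
  centeredCoord z k - centeredCoord z 0 ⊓ (centeredCoord z 1 ⊓ centeredCoord z 2)

theorem continuous_rootSum : Continuous rootSum := by
  have : rootSum = fun x => ((x 0 - x 1 / 2 - x 2 / 2 : ℝ) : ℂ) +
      ((√3 / 2 * (x 1 - x 2) : ℝ) : ℂ) * Complex.I := by
    funext x
    apply Complex.ext <;> simp [rootSum]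
  rw [this]
  fun_prop

theorem continuous_centeredCoord : Continuous centeredCoord := by
  refine continuous_pi fun k => ?_
  fin_cases k <;> simp only [centeredCoord] <;> simp <;> fun_prop

theorem continuous_legCoord : Continuous legCoord := by
  have h := fun k => (continuous_apply k).comp continuous_centeredCoord
  exact continuous_pi fun k => (h k).sub ((h 0).inf ((h 1).inf (h 2)))

theorem rootSum_legCoord (z : ℂ) : rootSum (legCoord z) = z := by
  have h3 : √3 ≠ 0 := by positivity
  apply Complex.ext
  · simp [rootSum, legCoord, centeredCoord]; ring
  · simp [rootSum, legCoord, centeredCoord]; field_simp; ring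

theorem legCoord_nonneg (z : ℂ) (k : Fin 3) : 0 ≤ legCoord z k := by
  unfold legCoord
  fin_cases k <;> simp

theorem exists_legCoord_eq_zero (z : ℂ) : ∃ k, legCoord z k = 0 := by
  unfold legCoord
  rcases min_choice (centeredCoord z 0) (centeredCoord z 1 ⊓ centeredCoord z 2) with h | h
  · exact ⟨0, by rw [h, sub_self]⟩
  · rcases min_choice (centeredCoord z 1) (centeredCoord z 2) with h' | h'
    · exact ⟨1, by rw [h, h', sub_self]⟩
    · exact ⟨2, by rw [h, h', sub_self]⟩

theorem legCoord_rootSum {x : Fin 3 → ℝ} (h0 : ∀ k, 0 ≤ x k) (h1 : ∃ k, x k = 0) :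
    legCoord (rootSum x) = x := by
  have h3 : √3 ≠ 0 := by positivity
  set m := (x 0 + x 1 + x 2) / 3 with hm
  have e0 : centeredCoord (rootSum x) 0 = x 0 - m := by
    simp [rootSum, centeredCoord]; ring
  have e1 : centeredCoord (rootSum x) 1 = x 1 - m := by
    simp [rootSum, centeredCoord]; field_simp; ring
  have e2 : centeredCoord (rootSum x) 2 = x 2 - m := by
    simp [rootSum, centeredCoord]; field_simp; ring
  have hmin : (x 0 - m) ⊓ ((x 1 - m) ⊓ (x 2 - m)) = -m := by
    obtain ⟨k, hk⟩ := h1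
    have a := h0 0
    have b := h0 1
    have c := h0 2
    apply le_antisymm
    · fin_cases k <;> simp at hk <;> simp [hk]
    · simp [a, b, c]
  funext k
  unfold legCoord
  rw [e0, e1, e2, hmin]
  fin_cases k <;> simp [e0, e1, e2]

theorem legCoord_smul {r : ℝ} (hr : 0 ≤ r) (z : ℂ) : legCoord (r • z) = r • legCoord z := by
  have hx : rootSum (r • legCoord z) = r • z := by
    conv_rhs => rw [← rootSum_legCoord z]
    apply Complex.ext <;> simp [rootSum] <;> ring
  rw [← hx, legCoord_rootSum]
  · exact fun k => mul_nonneg hr (legCoord_nonneg z k)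
  · obtain ⟨k, hk⟩ := exists_legCoord_eq_zero z
    exact ⟨k, by simp [hk]⟩

theorem rootSum_smul (r : ℝ) (x : Fin 3 → ℝ) : rootSum (r • x) = r • rootSum x := by
  apply Complex.ext <;> simp [rootSum] <;> ring

theorem rootSum_single (k : Fin 3) (t : ℝ) :
    rootSum (Pi.single k t) = t * Complex.exp (2 * Real.pi * Complex.I * ((k : ℕ) : ℂ) / 3) := by
  have hc : Real.cos (2 * Real.pi / 3) = -(1 / 2) := by
    rw [show 2 * Real.pi / 3 = Real.pi - Real.pi / 3 by ring, Real.cos_pi_sub,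
      Real.cos_pi_div_three]
  have hs : Real.sin (2 * Real.pi / 3) = √3 / 2 := by
    rw [show 2 * Real.pi / 3 = Real.pi - Real.pi / 3 by ring, Real.sin_pi_sub,
      Real.sin_pi_div_three]
  have h1 : Complex.exp (2 * Real.pi * Complex.I / 3) = ⟨-(1 / 2), √3 / 2⟩ := by
    rw [show (2 * Real.pi * Complex.I / 3 : ℂ) = ((2 * Real.pi / 3 : ℝ) : ℂ) * Complex.I by
      push_cast; ring]
    apply Complex.ext
    · rw [Complex.exp_ofReal_mul_I_re, hc]
    · rw [Complex.exp_ofReal_mul_I_im, hs]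
  have h2 : Complex.exp (2 * Real.pi * Complex.I * 2 / 3) = ⟨-(1 / 2), -(√3 / 2)⟩ := by
    rw [show (2 * Real.pi * Complex.I * 2 / 3 : ℂ) =
      2 * Real.pi * Complex.I / 3 + 2 * Real.pi * Complex.I / 3 by ring, Complex.exp_add, h1]
    have : √3 * √3 = 3 := Real.mul_self_sqrt (by norm_num)
    apply Complex.ext
    · simp; linarith
    · simp; ring
  fin_cases k
  · apply Complex.ext <;> simp [rootSum]
  · simp only [Fin.mk_one, Nat.cast_one, mul_one, h1]
    apply Complex.ext <;> simp [rootSum] <;> ring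
  · simp only [Fin.reduceFinMk, Nat.cast_ofNat, h2]
    apply Complex.ext <;> simp [rootSum] <;> ring

theorem mem_Tripod_iff {x : Fin 3 → ℝ} :
    x ∈ Tripod ↔ ∃ k, ∃ t ∈ Icc (0 : ℝ) 1, x = Pi.single k t := by
  constructor
  · rintro ⟨h, h'⟩
    by_cases hx : ∃ k, x k ≠ 0
    · obtain ⟨k, hk⟩ := hx
      refine ⟨k, x k, h k, funext fun j => ?_⟩
      rcases eq_or_ne j k with rfl | hj
      · simp
      · simpa [hj] using (h' j k hj).resolve_right hk
    · push Not at hx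
      exact ⟨0, 0, by simp, funext fun j => by simp [hx]⟩
  · rintro ⟨k, t, ht, rfl⟩
    refine ⟨fun j => ?_, fun i j hij => ?_⟩
    · rcases eq_or_ne j k with rfl | hj
      · simpa using ht
      · simp [hj]
    · rcases eq_or_ne i k with rfl | hi
      · simp [hij.symm]
      · simp [hi]

theorem Tripod.exists_eq_zero {x : Fin 3 → ℝ} (hx : x ∈ Tripod) : ∃ k, x k = 0 :=
  (hx.2 0 1 (by decide)).elim (fun h => ⟨0, h⟩) fun h => ⟨1, h⟩

theorem Tripod.legCoord_rootSum {x : Fin 3 → ℝ} (hx : x ∈ Tripod) :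
    legCoord (rootSum x) = x :=
  _root_.legCoord_rootSum (fun k => (hx.1 k).1) (exists_eq_zero hx)

theorem rootSum_image_Tripod : rootSum '' Tripod = Ygraph := by
  ext z
  simp only [Ygraph, mem_image, mem_Tripod_iff, mem_iUnion, mem_ofPred_eq]
  constructor
  · rintro ⟨_, ⟨k, t, ht, rfl⟩, rfl⟩
    exact ⟨k, t, ht, rootSum_single k t⟩
  · rintro ⟨k, t, ht, rfl⟩
    exact ⟨_, ⟨k, t, ht, rfl⟩, rootSum_single k t⟩

theorem legCoord_mem_Tripod {z : ℂ} (hz : z ∈ Ygraph) : legCoord z ∈ Tripod := by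
  obtain ⟨x, hx, rfl⟩ := rootSum_image_Tripod.ge hz
  rwa [Tripod.legCoord_rootSum hx]

/-- The Y-graph in the plane is homeomorphic to the one in leg coordinates. -/
noncomputable def ygraphHomeomorphTripod : Ygraph ≃ₜ Tripod where
  toFun z := ⟨legCoord z, legCoord_mem_Tripod z.2⟩
  invFun x := ⟨rootSum x, rootSum_image_Tripod ▸ mem_image_of_mem _ x.2⟩
  left_inv z := Subtype.ext (rootSum_legCoord z)
  right_inv x := Subtype.ext (Tripod.legCoord_rootSum x.2)
  continuous_toFun := (continuous_legCoord.comp continuous_subtype_val).subtype_mk _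
  continuous_invFun := (continuous_rootSum.comp continuous_subtype_val).subtype_mk _

theorem HollowTriangle.legCoord_rootSum {x : Fin 3 → ℝ} (hx : x ∈ HollowTriangle) :
    legCoord (rootSum x) = x :=
  _root_.legCoord_rootSum hx.1 hx.2.1

theorem rootSum_zero : rootSum 0 = 0 := by
  apply Complex.ext <;> simp [rootSum]

theorem legCoord_ne_zero {z : ℂ} (hz : z ≠ 0) : legCoord z ≠ 0 := fun h =>
  hz (by rw [← rootSum_legCoord z, h, rootSum_zero])

theorem HollowTriangle.rootSum_ne_zero {x : Fin 3 → ℝ} (hx : x ∈ HollowTriangle) :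
    rootSum x ≠ 0 := fun h => by
  have h0 : legCoord (rootSum 0) = 0 := _root_.legCoord_rootSum (fun _ => le_rfl) ⟨0, rfl⟩
  have : x = 0 := by rw [← legCoord_rootSum hx, h, ← h0, rootSum_zero]
  simpa [this] using hx.2.2

/-- Radial projection is a homeomorphism from the hollow triangle to the circle. -/
noncomputable def hollowTriangleHomeomorphCircle : HollowTriangle ≃ₜ Circle where
  toFun x := ⟨‖rootSum x‖⁻¹ • rootSum x, by
    have := HollowTriangle.rootSum_ne_zero x.2
    simp [Submonoid.unitSphere, this]⟩
  invFun z := ⟨‖legCoord z‖⁻¹ • legCoord z, by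
    refine ⟨fun k => ?_, ?_, ?_⟩
    · exact mul_nonneg (by positivity) (legCoord_nonneg z k)
    · obtain ⟨k, hk⟩ := exists_legCoord_eq_zero z
      exact ⟨k, by simp [hk]⟩
    · simp [norm_smul, legCoord_ne_zero z.coe_ne_zero]⟩
  left_inv x := by
    apply Subtype.ext
    have h : 0 < ‖rootSum x‖ := norm_pos_iff.2 (HollowTriangle.rootSum_ne_zero x.2)
    simp only [legCoord_smul (inv_nonneg.2 h.le), HollowTriangle.legCoord_rootSum x.2, norm_smul,
      x.2.2.2, norm_inv, norm_norm, mul_one, inv_inv, smul_smul]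
    rw [mul_inv_cancel₀ h.ne', one_smul]
  right_inv z := by
    apply Subtype.ext
    have h : 0 < ‖legCoord z‖ := norm_pos_iff.2 (legCoord_ne_zero z.coe_ne_zero)
    simp only [rootSum_smul, rootSum_legCoord, norm_smul, Circle.norm_coe, norm_inv, norm_norm,
      mul_one, inv_inv, smul_smul]
    rw [mul_inv_cancel₀ h.ne', one_smul]
  continuous_toFun := by
    have h : Continuous fun x : HollowTriangle => rootSum x :=
      continuous_rootSum.comp continuous_subtype_val
    exact ((h.norm.inv₀ fun x => norm_ne_zero_iff.2
      (HollowTriangle.rootSum_ne_zero x.2)).smul h).subtype_mk _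
  continuous_invFun := by
    have h : Continuous fun z : Circle => legCoord z :=
      continuous_legCoord.comp continuous_subtype_val
    exact ((h.norm.inv₀ fun z => norm_ne_zero_iff.2
      (legCoord_ne_zero z.coe_ne_zero)).smul h).subtype_mk _

/-- The straight-line motion of the point `x`, in the presence of the point `y`, towards the
normalized positive part of `x - y`. -/
noncomputable def spread (t : ℝ) (x y : Fin 3 → ℝ) (k : Fin 3) : ℝ :=
  (1 - t) * x k + t * (max (x k - y k) 0 / ‖x - y‖)

theorem spread_mem {t : ℝ} (ht : t ∈ Icc (0 : ℝ) 1) {x y : Fin 3 → ℝ} (hx : x ∈ Tripod)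
    (hy : y ∈ Tripod) : spread t x y ∈ Tripod := by
  obtain ⟨ht0, ht1⟩ := ht
  have ht1' : 0 ≤ 1 - t := sub_nonneg.2 ht1
  refine ⟨fun k => ⟨?_, ?_⟩, fun i j hij => ?_⟩
  · have := (hx.1 k).1
    unfold spread
    positivity
  · have h : max (x k - y k) 0 / ‖x - y‖ ≤ 1 := by
      refine div_le_one_of_le₀ (max_le ?_ (norm_nonneg _)) (norm_nonneg _)
      exact (le_abs_self _).trans (norm_le_pi_norm (x - y) k)
    have h' := (hx.1 k).2
    unfold spread
    nlinarith
  · have key : ∀ k, x k = 0 → spread t x y k = 0 := fun k hk => by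
      simp [spread, hk, (hy.1 k).1]
    exact (hx.2 i j hij).imp (key i) (key j)

theorem spread_ne {t : ℝ} (ht : t ∈ Icc (0 : ℝ) 1) {x y : Fin 3 → ℝ} (h : x ≠ y) :
    spread t x y ≠ spread t y x := by
  intro heq
  have hd : 0 < ‖x - y‖ := norm_pos_iff.2 (sub_ne_zero.2 h)
  refine h (funext fun k => ?_)
  have hk := congrFun heq k
  simp only [spread, norm_sub_rev y x] at hk
  have hmax : max (x k - y k) 0 - max (y k - x k) 0 = x k - y k := by
    rcases le_total (x k) (y k) with h' | h'
    · rw [max_eq_right (by linarith), max_eq_left (by linarith)]; ring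
    · rw [max_eq_left (by linarith), max_eq_right (by linarith)]; ring
  have hprod : ((1 - t) + t / ‖x - y‖) * (x k - y k) = 0 := by
    linear_combination hk - t / ‖x - y‖ * hmax
  have hpos : 0 < (1 - t) + t / ‖x - y‖ := by
    rcases ht.1.eq_or_lt with rfl | h0
    · simp
    · have := ht.2
      have := div_pos h0 hd
      linarith
  exact sub_eq_zero.1 ((mul_eq_zero.1 hprod).resolve_left hpos.ne')

/-- The straight-line motion of a configuration of two points on the tripod. -/
noncomputable def Conf.spread (t : unitInterval) (g : Conf Tripod 2) : Conf Tripod 2 :=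
  Conf.pair ⟨_root_.spread t (g.1 0) (g.1 1), spread_mem t.2 (g.1 0).2 (g.1 1).2⟩
    ⟨_root_.spread t (g.1 1) (g.1 0), spread_mem t.2 (g.1 1).2 (g.1 0).2⟩
    fun h => spread_ne t.2 (Subtype.coe_injective.ne (g.2.ne (by decide)))
      (congrArg Subtype.val h)

theorem Conf.sub_ne_zero (g : Conf Tripod 2) : (g.1 0 : Fin 3 → ℝ) - g.1 1 ≠ 0 :=
  _root_.sub_ne_zero.2 (Subtype.coe_injective.ne (g.2.ne (by decide)))

theorem Conf.continuous_coord (i : Fin 2) :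
    Continuous fun g : Conf Tripod 2 => (g.1 i : Fin 3 → ℝ) :=
  continuous_subtype_val.comp ((continuous_apply i).comp continuous_subtype_val)

theorem Conf.continuous_spread :
    Continuous fun p : unitInterval × Conf Tripod 2 => Conf.spread p.1 p.2 := by
  have key : ∀ i j : Fin 2, i ≠ j → Continuous fun p : unitInterval × Conf Tripod 2 =>
      _root_.spread p.1 (p.2.1 i) (p.2.1 j) := by
    intro i j hij
    have hi := (Conf.continuous_coord i).comp (continuous_snd (X := unitInterval))
    have hj := (Conf.continuous_coord j).comp (continuous_snd (X := unitInterval))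
    have ht : Continuous fun p : unitInterval × Conf Tripod 2 => (p.1 : ℝ) :=
      continuous_subtype_val.comp continuous_fst
    refine continuous_pi fun k => ?_
    have hik := (continuous_apply k).comp hi
    have hjk := (continuous_apply k).comp hj
    refine ((continuous_const.sub ht).mul hik).add (ht.mul (((hik.sub hjk).max
      continuous_const).div (hi.sub hj).norm fun p => ?_))
    exact norm_ne_zero_iff.2
      (_root_.sub_ne_zero.2 (Subtype.coe_injective.ne (p.2.2.ne hij)))
  exact Conf.continuous_pair ((key 0 1 (by decide)).subtype_mk _)
    ((key 1 0 (by decide)).subtype_mk _) _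

/-- The straight-line motion of an unordered pair of points on the tripod. -/
noncomputable def UConf.spread (t : unitInterval) : UConf Tripod 2 → UConf Tripod 2 :=
  UConf.lift₂ (fun g => UConf.mk (Conf.spread t g)) fun _ _ _ => UConf.mk_pair_comm _ _ _

theorem UConf.continuous_spread :
    Continuous fun p : unitInterval × UConf Tripod 2 => UConf.spread p.1 p.2 := by
  rw [(IsOpenQuotientMap.id.prodMap
    (UConf.isOpenQuotientMap_mk Tripod 2)).isQuotientMap.continuous_iff]
  exact continuous_quotient_mk'.comp Conf.continuous_spread

theorem UConf.spread_zero (c : UConf Tripod 2) : UConf.spread 0 c = c := by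
  obtain ⟨g, rfl⟩ := Quotient.mk_surjective c
  refine congrArg UConf.mk ((Subtype.ext (funext fun i => Subtype.ext (funext fun k => ?_))))
  fin_cases i <;> simp [Conf.spread, Conf.pair, _root_.spread]

theorem pi_norm_abs (x : Fin 3 → ℝ) : ‖|x|‖ = ‖x‖ := by
  simp [Pi.norm_def, Pi.abs_apply]

theorem normalized_abs_sub_mem {x y : Fin 3 → ℝ} (hx : x ∈ Tripod) (hy : y ∈ Tripod)
    (h : x - y ≠ 0) : ‖x - y‖⁻¹ • |x - y| ∈ HollowTriangle := by
  refine ⟨fun k => ?_, ?_, ?_⟩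
  · exact mul_nonneg (by positivity) (abs_nonneg (x k - y k))
  · have key : ∃ k, x k = 0 ∧ y k = 0 := by
      have x01 := hx.2 0 1 (by decide)
      have x02 := hx.2 0 2 (by decide)
      have x12 := hx.2 1 2 (by decide)
      have y01 := hy.2 0 1 (by decide)
      have y02 := hy.2 0 2 (by decide)
      have y12 := hy.2 1 2 (by decide)
      simp only [Fin.exists_fin_succ]
      grind
    obtain ⟨k, hxk, hyk⟩ := key
    exact ⟨k, by simp [hxk, hyk]⟩
  · rw [norm_smul, norm_inv, norm_norm, pi_norm_abs, inv_mul_cancel₀ (norm_ne_zero_iff.2 h)]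

/-- The normalized absolute difference of the leg coordinates of an ordered pair of points. -/
noncomputable def Conf.toHollowTriangle (g : Conf Tripod 2) : HollowTriangle :=
  ⟨_, normalized_abs_sub_mem (g.1 0).2 (g.1 1).2 g.sub_ne_zero⟩

theorem Conf.continuous_toHollowTriangle : Continuous Conf.toHollowTriangle := by
  have h := (Conf.continuous_coord 0).sub (Conf.continuous_coord 1)
  refine Continuous.subtype_mk ((h.norm.inv₀ fun g => ?_).smul ?_) _
  · exact norm_ne_zero_iff.2 g.sub_ne_zero
  · exact continuous_pi fun k => ((continuous_apply k).comp h).abs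

/-- The map from unordered pairs of points on the tripod to the hollow triangle. -/
noncomputable def UConf.toHollowTriangle : C(UConf Tripod 2, HollowTriangle) where
  toFun := UConf.lift₂ Conf.toHollowTriangle fun a b _ => Subtype.ext (by
    change ‖(a : Fin 3 → ℝ) - b‖⁻¹ • |(a : Fin 3 → ℝ) - b| =
      ‖(b : Fin 3 → ℝ) - a‖⁻¹ • |(b : Fin 3 → ℝ) - a|
    rw [norm_sub_rev, abs_sub_comm])
  continuous_toFun := Conf.continuous_toHollowTriangle.quotient_lift _

theorem HollowTriangle.exists_ne_zero {x : Fin 3 → ℝ} (hx : x ∈ HollowTriangle) :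
    ∃ k, x k ≠ 0 := by
  by_contra! h
  have : x = 0 := funext h
  simpa [this] using hx.2.2

theorem HollowTriangle.le_one {x : Fin 3 → ℝ} (hx : x ∈ HollowTriangle) (k : Fin 3) :
    x k ≤ 1 :=
  (le_abs_self _).trans ((norm_le_pi_norm x k).trans hx.2.2.le)

theorem HollowTriangle.single_mem {x : Fin 3 → ℝ} (hx : x ∈ HollowTriangle) (k : Fin 3) :
    Pi.single k (x k) ∈ Tripod :=
  mem_Tripod_iff.2 ⟨k, x k, ⟨hx.1 k, le_one hx k⟩, rfl⟩

theorem HollowTriangle.update_mem {x : Fin 3 → ℝ} (hx : x ∈ HollowTriangle) {k : Fin 3}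
    (hk : x k ≠ 0) : Function.update x k 0 ∈ Tripod := by
  refine ⟨fun j => ?_, fun i j hij => ?_⟩
  · rcases eq_or_ne j k with rfl | hj
    · simp
    · simpa [hj] using ⟨hx.1 j, le_one hx j⟩
  · rcases eq_or_ne i k with rfl | hi
    · simp
    rcases eq_or_ne j k with rfl | hj
    · simp
    obtain ⟨l, hl⟩ := hx.2.1
    have hlk : l ≠ k := fun h => hk (h ▸ hl)
    have : l = i ∨ l = j := by omega
    rcases this with rfl | rfl <;> simp [hi, hj, hl]

/-- The pair of points on the tripod whose coordinates add up to `x`, the first of which lies on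
the leg `k`. -/
noncomputable def HollowTriangle.split (k : Fin 3) (x : {x : HollowTriangle // x.1 k ≠ 0}) :
    Conf Tripod 2 :=
  Conf.pair ⟨_, single_mem x.1.2 k⟩ ⟨_, update_mem x.1.2 x.2⟩ fun h => x.2 (by
    simpa using congrFun (congrArg Subtype.val h) k)

theorem HollowTriangle.continuous_split (k : Fin 3) : Continuous (split k) := by
  have h : Continuous fun x : {x : HollowTriangle // x.1 k ≠ 0} => (x.1 : Fin 3 → ℝ) :=
    continuous_subtype_val.comp continuous_subtype_val
  refine Conf.continuous_pair ?_ ?_ _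
  · exact ((continuous_single k).comp ((continuous_apply k).comp h)).subtype_mk _
  · exact (h.update k continuous_const).subtype_mk _

theorem HollowTriangle.mk_split_eq (x : HollowTriangle) {k l : Fin 3} (hk : x.1 k ≠ 0)
    (hl : x.1 l ≠ 0) : UConf.mk (split k ⟨x, hk⟩) = UConf.mk (split l ⟨x, hl⟩) := by
  rcases eq_or_ne k l with rfl | hkl
  · rfl
  unfold split
  rw [UConf.mk_pair_comm]
  have key : ∀ {k l : Fin 3}, x.1 k ≠ 0 → x.1 l ≠ 0 → k ≠ l →
      Function.update x.1 k 0 = Pi.single l (x.1 l) := by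
    intro k l hk hl hkl
    obtain ⟨m, hm⟩ := x.2.2.1
    have hmk : m ≠ k := fun h => hk (h ▸ hm)
    have hml : m ≠ l := fun h => hl (h ▸ hm)
    funext j
    have : j = k ∨ j = l ∨ j = m := by omega
    rcases this with rfl | rfl | rfl
    · simp [hkl]
    · simp [hkl.symm]
    · simp [hmk, hml, hm]
  congr 2
  · exact Subtype.ext (key hk hl hkl)
  · exact Subtype.ext (key hl hk hkl.symm).symm

/-- The embedding of the hollow triangle in the space of unordered pairs of points. -/
noncomputable def HollowTriangle.toUConf (x : HollowTriangle) : UConf Tripod 2 :=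
  UConf.mk (split _ ⟨x, (exists_ne_zero x.2).choose_spec⟩)

theorem HollowTriangle.toUConf_eq (x : HollowTriangle) {k : Fin 3} (hk : x.1 k ≠ 0) :
    toUConf x = UConf.mk (split k ⟨x, hk⟩) :=
  mk_split_eq x _ hk

theorem HollowTriangle.continuous_toUConf : Continuous HollowTriangle.toUConf := by
  refine continuous_iff_continuousAt.2 fun x => ?_
  obtain ⟨k, hk⟩ := exists_ne_zero x.2
  have hopen : IsOpen {x : HollowTriangle | x.1 k ≠ 0} :=
    isOpen_ne_fun ((continuous_apply k).comp continuous_subtype_val) continuous_const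
  refine ContinuousOn.continuousAt (s := {x : HollowTriangle | x.1 k ≠ 0}) ?_
    (hopen.mem_nhds hk)
  rw [continuousOn_iff_continuous_domRestrict]
  exact (continuous_quotient_mk'.comp (continuous_split k)).congr fun y =>
    (toUConf_eq y.1 y.2).symm

theorem HollowTriangle.toHollowTriangle_toUConf (x : HollowTriangle) :
    UConf.toHollowTriangle (toUConf x) = x := by
  obtain ⟨k, hk⟩ := exists_ne_zero x.2
  rw [toUConf_eq x hk]
  apply Subtype.ext
  have habs : |(Pi.single k (x.1 k) : Fin 3 → ℝ) - Function.update x.1 k 0| = x.1 := by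
    funext j
    rcases eq_or_ne j k with rfl | hj
    · simp [Pi.abs_apply, x.2.1 j]
    · simp [Pi.abs_apply, hj, x.2.1 j]
  change ‖(Pi.single k (x.1 k) : Fin 3 → ℝ) - Function.update x.1 k 0‖⁻¹ •
    |(Pi.single k (x.1 k) : Fin 3 → ℝ) - Function.update x.1 k 0| = x.1
  rw [← pi_norm_abs, habs, x.2.2.2, inv_one, one_smul]

theorem Conf.toUConf_toHollowTriangle_of_lt (g : Conf Tripod 2) {k : Fin 3}
    (hk : (g.1 1).1 k < (g.1 0).1 k) :
    HollowTriangle.toUConf g.toHollowTriangle = UConf.mk (Conf.spread 1 g) := by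
  have hd : 0 < ‖(g.1 0 : Fin 3 → ℝ) - g.1 1‖ := norm_pos_iff.2 g.sub_ne_zero
  have hk' : g.toHollowTriangle.1 k ≠ 0 := by
    have : (g.1 0).1 k - (g.1 1).1 k ≠ 0 := by linarith
    simpa [Conf.toHollowTriangle, hd.ne'] using this
  have hle : ∀ j, j ≠ k → (g.1 0).1 j = 0 := fun j hj =>
    ((g.1 0).2.2 j k hj).resolve_right (((g.1 1).2.1 k).1.trans_lt hk).ne'
  rw [HollowTriangle.toUConf_eq _ hk']
  unfold HollowTriangle.split Conf.spread
  congr 2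
  · refine Subtype.ext (funext fun j => ?_)
    rcases eq_or_ne j k with rfl | hj
    · simp [Conf.toHollowTriangle, _root_.spread, abs_of_pos (sub_pos.2 hk), hk.le,
        div_eq_inv_mul]
    · simp [_root_.spread, hj, hle j hj, ((g.1 1).2.1 j).1]
  · refine Subtype.ext (funext fun j => ?_)
    rcases eq_or_ne j k with rfl | hj
    · simp [_root_.spread, hk.le]
    · simp [Conf.toHollowTriangle, _root_.spread, hj, hle j hj, abs_of_nonneg,
        ((g.1 1).2.1 j).1, div_eq_inv_mul, norm_sub_rev]

theorem UConf.toUConf_toHollowTriangle (c : UConf Tripod 2) :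
    HollowTriangle.toUConf (UConf.toHollowTriangle c) = UConf.spread 1 c := by
  obtain ⟨g, rfl⟩ := Quotient.mk_surjective c
  obtain ⟨k, hk⟩ := Function.ne_iff.1 (_root_.sub_ne_zero.1 g.sub_ne_zero)
  rcases hk.lt_or_gt with h | h
  · rw [show (Quotient.mk _ g : UConf Tripod 2) = _ from
      (congrArg UConf.mk g.eq_pair).trans (UConf.mk_pair_comm _ _ _)]
    exact Conf.toUConf_toHollowTriangle_of_lt (Conf.pair (g.1 1) (g.1 0) _) h
  · exact Conf.toUConf_toHollowTriangle_of_lt g h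

/-- The space of unordered pairs of points on the tripod deformation retracts onto the hollow
triangle. -/
noncomputable def uconfHomotopyEquivHollowTriangle :
    ContinuousMap.HomotopyEquiv (UConf Tripod 2) HollowTriangle where
  toFun := UConf.toHollowTriangle
  invFun := ⟨HollowTriangle.toUConf, HollowTriangle.continuous_toUConf⟩
  left_inv := .symm ⟨{
    toFun := fun p => UConf.spread p.1 p.2
    continuous_toFun := UConf.continuous_spread
    map_zero_left := UConf.spread_zero
    map_one_left := fun c => (UConf.toUConf_toHollowTriangle c).symm }⟩
  right_inv := by
    have h : UConf.toHollowTriangle.comp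
        ⟨HollowTriangle.toUConf, HollowTriangle.continuous_toUConf⟩ = .id _ :=
      ContinuousMap.ext fun x => HollowTriangle.toHollowTriangle_toUConf x
    rw [h]

/-- The unordered configuration space of two points on the Y-graph is homotopy equivalent
to the circle. -/
theorem stmt11 : Nonempty (ContinuousMap.HomotopyEquiv (UConf ↥Ygraph 2) Circle) := by
  exact ⟨((UConf.congr ygraphHomeomorphTripod 2).toHomotopyEquiv.trans
    uconfHomotopyEquivHollowTriangle).trans hollowTriangleHomeomorphCircle.toHomotopyEquiv⟩
end

section
/- Let p, q be natural numbers and let Γ be the topological space (Fin p) ⊕ (Fin q × [0,1]), i.e. the disjoint union of p points and q closed unit intervals. Then for every n ≥ 1 there exists a natural number m such that the unordered configuration space UConf(Γ,n) = Conf(Γ,n)/Σ_n is homotopy equivalent to the discrete space Fin m. (This is case (1) of the main theorem: for graphs in the class 𝓛 the unordered configuration space is homotopy equivalent to a finite discrete space, so the canonical bundle ξ_{Γ,n} is trivial and has order 1.) -/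
open scoped unitInterval

/-- A `T1` space whose identity map is homotopic to a map with finite range is homotopy
equivalent to a finite discrete space. -/
theorem exists_homotopyEquiv_fin_of_homotopy_finite_range {X : Type*} [TopologicalSpace X]
    [T1Space X] (T : C(X, X)) (H : ContinuousMap.Homotopy (ContinuousMap.id X) T)
    (hT : (Set.range T).Finite) :
    ∃ m : ℕ, Nonempty (ContinuousMap.HomotopyEquiv X (Fin m)) := by
  have : Finite (Set.range T) := hT
  let r : C(X, Set.range T) := ⟨Set.rangeFactorization T, by fun_prop⟩
  let ι : C(Set.range T, X) := ⟨Subtype.val, continuous_subtype_val⟩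
  have r_T (x : X) : r (T x) = r x := by
    have hc : Continuous fun t : I => r (H (t, x)) := by fun_prop
    have h := PreconnectedSpace.constant (inferInstance : PreconnectedSpace I) hc
      (x := 1) (y := 0)
    simpa using h
  have hrι : r.comp ι = ContinuousMap.id _ := by
    ext ⟨_, x, rfl⟩
    exact congrArg Subtype.val (r_T x)
  let E : ContinuousMap.HomotopyEquiv X (Set.range T) :=
    { toFun := r
      invFun := ι
      left_inv := ⟨H.symm⟩
      right_inv := hrι ▸ ContinuousMap.Homotopic.refl _ }
  obtain ⟨m, ⟨e⟩⟩ := Finite.exists_equiv_fin (Set.range T)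
  exact ⟨m, ⟨E.trans (e.toHomeomorphOfDiscrete).toHomotopyEquiv⟩⟩

instance continuousConstSMul_conf (X : Type*) [TopologicalSpace X] (n : ℕ) :
    ContinuousConstSMul (Equiv.Perm (Fin n)) (Conf X n) where
  continuous_const_smul τ :=
    continuous_induced_rng.2 <| continuous_pi fun i =>
      (continuous_apply (τ⁻¹ i)).comp continuous_subtype_val

theorem conf_smul_apply {X : Type*} [TopologicalSpace X] {n : ℕ} (τ : Equiv.Perm (Fin n))
    (f : Conf X n) (i : Fin n) : (τ • f).1 i = f.1 (τ⁻¹ i) := rfl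

/-- The quotient of a `T1` space by a finite group acting by homeomorphisms is `T1`. -/
theorem t1Space_quotient_orbitRel (G X : Type*) [Group G] [Finite G] [TopologicalSpace X]
    [T1Space X] [MulAction G X] : T1Space (Quotient (MulAction.orbitRel G X)) where
  t1 x := by
    induction x using Quotient.inductionOn with | h x => ?_
    rw [← isQuotientMap_quotient_mk'.isClosed_preimage]
    have : (Quotient.mk (MulAction.orbitRel G X)) ⁻¹' {Quotient.mk _ x} = MulAction.orbit G x := by
      ext y
      simp only [Set.mem_preimage, Set.mem_singleton_iff, Quotient.eq]
      exact MulAction.orbitRel_apply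
    exact this ▸ (Set.finite_range _).isClosed

/-- An equivariant homotopy of `X` from the identity to a map whose image in the orbit space is
finite exhibits the orbit space by a finite group as homotopy equivalent to a finite discrete
space. -/
theorem exists_quotient_homotopyEquiv_fin {G X : Type*} [Group G] [Finite G]
    [TopologicalSpace X] [T1Space X] [MulAction G X] [ContinuousConstSMul G X]
    (H : I × X → X) (hH : Continuous H) (hG : ∀ (g : G) t x, H (t, g • x) = g • H (t, x))
    (h_zero : ∀ x, H (0, x) = x) (hfin : (Set.range fun x => H (1, x)).Finite) :
    ∃ m : ℕ, Nonempty
      (ContinuousMap.HomotopyEquiv (Quotient (MulAction.orbitRel G X)) (Fin m)) := by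
  have := t1Space_quotient_orbitRel G X
  let π : X → Quotient (MulAction.orbitRel G X) := Quotient.mk _
  have hπ : IsOpenQuotientMap π := MulAction.isOpenQuotientMap_quotientMk
  let K : I × Quotient (MulAction.orbitRel G X) → Quotient (MulAction.orbitRel G X) := fun y =>
    Quotient.lift (fun x => π (H (y.1, x)))
      (by
        rintro _ x ⟨g, rfl⟩
        exact Quotient.sound ⟨g, (hG g y.1 x).symm⟩) y.2
  have hK : Continuous K := by
    rw [(IsOpenQuotientMap.id.prodMap hπ).isQuotientMap.continuous_iff]
    exact hπ.continuous.comp hH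
  refine exists_homotopyEquiv_fin_of_homotopy_finite_range ⟨fun x => K (1, x), by fun_prop⟩
    { toFun := K
      continuous_toFun := hK
      map_zero_left := ?_
      map_one_left := fun _ => rfl } ?_
  · rintro ⟨x⟩
    exact congrArg π (h_zero x)
  · refine (hfin.image π).subset ?_
    rintro _ ⟨⟨x⟩, rfl⟩
    exact ⟨_, ⟨x, rfl⟩, rfl⟩

section PointsAndIntervals

variable {p q n : ℕ}

/-- An injective continuous function placing the points and intervals disjointly on the line. -/
def linePosition : Fin p ⊕ (Fin q × I) → ℝ :=
  Sum.elim (fun a => -1 - (a : ℝ)) (fun y => 2 * (y.1 : ℝ) + y.2)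

theorem continuous_linePosition : Continuous (linePosition (p := p) (q := q)) := by
  refine continuous_sumElim.2 ⟨continuous_of_discreteTopology, ?_⟩
  have : Continuous fun j : Fin q => (j : ℝ) := continuous_of_discreteTopology
  fun_prop

theorem linePosition_injective : Function.Injective (linePosition (p := p) (q := q)) := by
  rintro (a | ⟨j, s⟩) (b | ⟨k, t⟩) h <;> simp only [linePosition, Sum.elim_inl, Sum.elim_inr] at h
  · have : (a : ℝ) = b := by linarith
    rw [Fin.ext (Nat.cast_injective this)]
  · have := t.2.1
    have : (0 : ℝ) ≤ (a : ℕ) := Nat.cast_nonneg _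
    have : (0 : ℝ) ≤ (k : ℕ) := Nat.cast_nonneg _
    linarith
  · have := s.2.1
    have : (0 : ℝ) ≤ (b : ℕ) := Nat.cast_nonneg _
    have : (0 : ℝ) ≤ (j : ℕ) := Nat.cast_nonneg _
    linarith
  · have hs := s.2
    have ht := t.2
    have hjk : (j : ℕ) < k + 1 := by
      have : (j : ℝ) < k + 1 := by linarith [hs.1, ht.2]
      exact_mod_cast this
    have hkj : (k : ℕ) < j + 1 := by
      have : (k : ℝ) < j + 1 := by linarith [hs.2, ht.1]
      exact_mod_cast this
    obtain rfl : j = k := Fin.ext (by omega)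
    obtain rfl : s = t := Subtype.ext (by linarith)
    rfl

/-- The number of points of a configuration strictly to the left of its `i`-th point. -/
noncomputable def confRank (f : Conf (Fin p ⊕ (Fin q × I)) n) (i : Fin n) : ℕ :=
  ∑ k, {g : Conf (Fin p ⊕ (Fin q × I)) n |
    linePosition (g.1 k) < linePosition (g.1 i)}.indicator (fun _ => 1) f

theorem confRank_eq_card (f : Conf (Fin p ⊕ (Fin q × I)) n) (i : Fin n) :
    confRank f i =
      (Finset.univ.filter fun k => linePosition (f.1 k) < linePosition (f.1 i)).card := by
  simp [confRank, Set.indicator_apply]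

theorem confRank_le (f : Conf (Fin p ⊕ (Fin q × I)) n) (i : Fin n) : confRank f i ≤ n := by
  rw [confRank_eq_card]
  exact (Finset.card_le_univ _).trans_eq (Fintype.card_fin n)

theorem confRank_smul (τ : Equiv.Perm (Fin n)) (f : Conf (Fin p ⊕ (Fin q × I)) n) (i : Fin n) :
    confRank (τ • f) i = confRank f (τ⁻¹ i) := by
  simp only [confRank, Set.indicator_apply, Set.mem_ofPred_eq, conf_smul_apply]
  exact Equiv.sum_comp τ⁻¹
    (fun k => if linePosition (f.1 k) < linePosition (f.1 (τ⁻¹ i)) then 1 else 0)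

theorem confRank_lt_confRank (f : Conf (Fin p ⊕ (Fin q × I)) n) {i k : Fin n}
    (h : linePosition (f.1 i) < linePosition (f.1 k)) : confRank f i < confRank f k := by
  rw [confRank_eq_card, confRank_eq_card]
  refine Finset.card_lt_card (Finset.ssubset_iff_of_subset ?_ |>.2 ⟨i, by simpa using h, by simp⟩)
  intro l hl
  simp only [Finset.mem_filter, Finset.mem_univ, true_and] at hl ⊢
  exact hl.trans h

theorem continuous_confRank (i : Fin n) :
    Continuous fun f : Conf (Fin p ⊕ (Fin q × I)) n => confRank f i := by
  have hc (k : Fin n) :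
      Continuous fun g : Conf (Fin p ⊕ (Fin q × I)) n => linePosition (g.1 k) :=
    continuous_linePosition.comp ((continuous_apply k).comp continuous_subtype_val)
  refine continuous_finsetSum _ fun k _ => IsClopen.continuous_indicator ?_ continuous_const
  refine ⟨?_, isOpen_lt (hc k) (hc i)⟩
  rcases eq_or_ne k i with rfl | hki
  · simp
  · convert isClosed_le (hc k) (hc i) using 3 with g
    exact ⟨le_of_lt, fun h => lt_of_le_of_ne h fun h' => hki (g.2 (linePosition_injective h'))⟩

/-- The rank of a point, rescaled to lie in the unit interval. -/
noncomputable def confRankRatio (f : Conf (Fin p ⊕ (Fin q × I)) n) (i : Fin n) : I :=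
  ⟨(confRank f i : ℝ) / n, by positivity,
    div_le_one_of_le₀ (Nat.cast_le.2 (confRank_le f i)) (Nat.cast_nonneg n)⟩

theorem continuous_confRankRatio (i : Fin n) :
    Continuous fun f : Conf (Fin p ⊕ (Fin q × I)) n => confRankRatio f i := by
  refine Continuous.subtype_mk (Continuous.div_const ?_ _) _
  exact (continuous_of_discreteTopology (f := fun k : ℕ => (k : ℝ))).comp (continuous_confRank i)

theorem confRankRatio_lt (f : Conf (Fin p ⊕ (Fin q × I)) n) {i k : Fin n}
    (h : linePosition (f.1 i) < linePosition (f.1 k)) :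
    (confRankRatio f i : ℝ) < confRankRatio f k := by
  have hn : (0 : ℝ) < n := Nat.cast_pos.2 i.pos
  exact div_lt_div_of_pos_right (Nat.cast_lt.2 (confRank_lt_confRank f h)) hn

/-- The point dividing the segment from `u` to `s` in the ratio `t`. -/
def unitSegment (t s u : I) : I :=
  ⟨(1 - (t : ℝ)) * u + t * s,
    (convex_Icc (0 : ℝ) 1) u.2 s.2 (sub_nonneg.2 t.2.2) t.2.1 (sub_add_cancel _ _)⟩

theorem continuous_unitSegment : Continuous fun y : I × I × I => unitSegment y.1 y.2.1 y.2.2 := by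
  unfold unitSegment
  fun_prop

/-- Moves the points lying on an interval along that interval towards the parameter `s`. -/
def slideTowards (t s : I) : Fin p ⊕ (Fin q × I) → Fin p ⊕ (Fin q × I) :=
  Sum.map id (Prod.map id (unitSegment t s))

theorem continuous_slideTowards :
    Continuous fun y : (I × I) × (Fin p ⊕ (Fin q × I)) => slideTowards y.1.1 y.1.2 y.2 := by
  rw [← (Homeomorph.prodSumDistrib (X := I × I) (Y := Fin p)
    (Z := Fin q × I)).symm.comp_continuous_iff']
  refine continuous_sum_dom.2 ⟨?_, ?_⟩
  · exact continuous_inl.comp continuous_snd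
  · refine continuous_inr.comp (f := fun y : (I × I) × (Fin q × I) =>
      (y.2.1, unitSegment y.1.1 y.1.2 y.2.2)) ?_
    exact Continuous.prodMk (by fun_prop) (continuous_unitSegment.comp
      (f := fun y : (I × I) × (Fin q × I) => (y.1.1, y.1.2, y.2.2)) (by fun_prop))

theorem slideTowards_confRankRatio_injective (t : I) (f : Conf (Fin p ⊕ (Fin q × I)) n) :
    Function.Injective fun i => slideTowards t (confRankRatio f i) (f.1 i) := by
  have key (i k : Fin n) (h : linePosition (f.1 i) < linePosition (f.1 k)) :
      slideTowards t (confRankRatio f i) (f.1 i) ≠ slideTowards t (confRankRatio f k) (f.1 k) := by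
    have hr := confRankRatio_lt f h
    intro he
    rcases hi : f.1 i with a | ⟨j, u⟩ <;> rcases hk : f.1 k with b | ⟨l, v⟩ <;>
      rw [hi, hk] at he h <;> simp only [slideTowards, Sum.map_inl, Sum.map_inr, Prod.map_apply,
        id, Sum.inl.injEq, Sum.inr.injEq, Prod.mk.injEq, reduceCtorEq] at he
    · exact h.ne (by rw [he])
    · obtain ⟨rfl, he⟩ := he
      have he := congrArg Subtype.val he
      simp only [linePosition, Sum.elim_inr, unitSegment] at h he
      have huv : (u : ℝ) < v := by linarith
      rcases t.2.1.eq_or_lt with ht | ht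
      · rw [← ht] at he
        linarith
      · nlinarith [mul_nonneg (sub_nonneg.2 t.2.2) (sub_pos.2 huv).le, mul_pos ht (sub_pos.2 hr)]
  intro i k he
  rcases lt_trichotomy (linePosition (f.1 i)) (linePosition (f.1 k)) with h | h | h
  · exact (key i k h he).elim
  · exact f.2 (linePosition_injective h)
  · exact (key k i h he.symm).elim

/-- The deformation of the configuration space sliding the points on every interval to positions
determined by their ranks. -/
noncomputable def confSlide (y : I × Conf (Fin p ⊕ (Fin q × I)) n) :
    Conf (Fin p ⊕ (Fin q × I)) n :=
  ⟨fun i => slideTowards y.1 (confRankRatio y.2 i) (y.2.1 i),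
    slideTowards_confRankRatio_injective y.1 y.2⟩

theorem continuous_confSlide : Continuous (confSlide (p := p) (q := q) (n := n)) := by
  refine Continuous.subtype_mk (continuous_pi fun i => ?_) _
  exact continuous_slideTowards.comp
    ((continuous_fst.prodMk ((continuous_confRankRatio i).comp continuous_snd)).prodMk
      ((continuous_apply i).comp (continuous_subtype_val.comp continuous_snd)))

theorem confSlide_smul (τ : Equiv.Perm (Fin n)) (t : I) (f : Conf (Fin p ⊕ (Fin q × I)) n) :
    confSlide (t, τ • f) = τ • confSlide (t, f) := by
  refine Subtype.ext (funext fun i => ?_)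
  simp only [conf_smul_apply, confSlide, confRankRatio, confRank_smul]

theorem confSlide_zero (f : Conf (Fin p ⊕ (Fin q × I)) n) : confSlide (0, f) = f := by
  refine Subtype.ext (funext fun i => ?_)
  rcases h : f.1 i with a | ⟨j, u⟩ <;> simp [confSlide, h, slideTowards, unitSegment]

theorem finite_range_confSlide_one :
    (Set.range fun f : Conf (Fin p ⊕ (Fin q × I)) n => confSlide (1, f)).Finite := by
  let A : Set (Fin p ⊕ (Fin q × I)) := Set.range
    (Sum.map id fun y : Fin q × Fin (n + 1) =>
      (y.1, Set.projIcc (0 : ℝ) 1 zero_le_one ((y.2 : ℝ) / n)))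
  have hA : A.Finite := Set.finite_range _
  refine ((Set.Finite.pi' fun _ : Fin n => hA).preimage
    Subtype.val_injective.injOn).subset ?_
  rintro _ ⟨f, rfl⟩ i
  rcases h : f.1 i with a | ⟨j, u⟩
  · exact ⟨Sum.inl a, by simp [confSlide, h, slideTowards]⟩
  · refine ⟨Sum.inr (j, ⟨confRank f i, Nat.lt_succ_of_le (confRank_le f i)⟩), ?_⟩
    have hs := Set.projIcc_val (zero_le_one (α := ℝ)) (confRankRatio f i)
    simp only [confRankRatio] at hs
    simp [confSlide, h, slideTowards, unitSegment, confRankRatio, hs]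

end PointsAndIntervals

/-- For a graph that is a disjoint union of finitely many points and closed intervals, the
unordered configuration space is homotopy equivalent to a finite discrete space. -/
theorem stmt16 (p q : ℕ) (n : ℕ) (hn : 1 ≤ n) :
    ∃ m : ℕ, Nonempty
      (ContinuousMap.HomotopyEquiv (UConf ((Fin p) ⊕ (Fin q × unitInterval)) n) (Fin m)) := by
  exact exists_quotient_homotopyEquiv_fin confSlide continuous_confSlide confSlide_smul
    confSlide_zero finite_range_confSlide_one
end
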